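/- Let P be the set of points of GQ(2,2) and for a geometric hyperplane H of GQ(2,2) let f_H : P → ZMod 2 be the function f_H = 1 + χ_H, where χ_H is the indicator function of H. Then the set {0} ∪ {f_H : H a geometric hyperplane of GQ(2,2)} is an F2-linear subspace of (P → ZMod 2) of dimension 5. (Hence the Veldkamp space of GQ(2,2) is isomorphic to PG(4,2).) -/

import Mathlib

/-- The points of GQ(2,2): the 2-element subsets of `Fin 6`. -/
abbrev GQP : Type := {s : Finset (Fin 6) // s.card = 2}

/-- The lines of GQ(2,2): 3-element sets of pairwise disjoint 2-element subsets of `Fin 6`. -/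
def GQLine (L : Finset GQP) : Prop :=
  L.card = 3 ∧ ∀ p ∈ L, ∀ q ∈ L, p ≠ q → Disjoint p.1 q.1

/-- A geometric hyperplane of GQ(2,2). -/
def GQHyp (H : Finset GQP) : Prop :=
  H ≠ Finset.univ ∧ ∀ L : Finset GQP, GQLine L → (L ∩ H).card = 1 ∨ (L ∩ H).card = 3

/-- `fH H = 1 + χ_H`, where `χ_H` is the indicator function of `H`. -/
def fH (H : Finset GQP) : GQP → ZMod 2 :=
  fun p => 1 + (if p ∈ H then 1 else 0)


/-- The point `{i, j}`. -/
def pt (i j : Fin 6) (h : i ≠ j) : GQP := ⟨{i, j}, Finset.card_pair h⟩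

/-- Parametrization of the functions summing to zero on lines. -/
def phi : (Fin 5 → ZMod 2) →ₗ[ZMod 2] (GQP → ZMod 2) where
  toFun a p := ∑ k : Fin 5, if k.castSucc ∈ p.1 then 0 else a k
  map_add' a b := by
    ext p
    simp only [Pi.add_apply, ← Finset.sum_add_distrib]
    refine Finset.sum_congr rfl fun k _ => ?_
    split_ifs <;> simp
  map_smul' c a := by
    ext p
    simp only [Pi.smul_apply, smul_eq_mul, Finset.mul_sum, RingHom.id_apply]
    refine Finset.sum_congr rfl fun k _ => ?_
    split_ifs <;> simp

theorem phi_pt (a : Fin 5 → ZMod 2) (i j : Fin 6) (h : i ≠ j) :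
    phi a (pt i j h) = ∑ k : Fin 5, if k.castSucc = i ∨ k.castSucc = j then 0 else a k := by
  simp [phi, pt]

theorem two_zero : (2 : ZMod 2) = 0 := rfl

theorem phi_inj : Function.Injective phi := by
  rw [← LinearMap.ker_eq_bot, LinearMap.ker_eq_bot']
  intro a ha
  have e (i j : Fin 6) (h : i ≠ j) := (phi_pt a i j h).symm.trans (congrFun ha _)
  have h1 := e 0 1 (by decide)
  have h2 := e 0 5 (by decide)
  have h3 := e 1 5 (by decide)
  have h4 := e 2 5 (by decide)
  have h5 := e 3 5 (by decide)
  have h6 := e 4 5 (by decide)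
  simp +decide only [Fin.sum_univ_five, if_true, if_false, Pi.zero_apply] at h1 h2 h3 h4 h5 h6
  have fin : ∀ a b c d e : ZMod 2, 0 + 0 + c + d + e = 0 → 0 + b + c + d + e = 0 →
      a + 0 + c + d + e = 0 → a + b + 0 + d + e = 0 → a + b + c + 0 + e = 0 →
      a + b + c + d + 0 = 0 → a = 0 ∧ b = 0 ∧ c = 0 ∧ d = 0 ∧ e = 0 := by decide
  obtain ⟨u0, u1, u2, u3, u4⟩ := fin _ _ _ _ _ h1 h2 h3 h4 h5 h6
  ext k
  fin_cases k <;> assumption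

theorem phi_line (a : Fin 5 → ZMod 2) (p q r : GQP) (h1 : Disjoint p.1 q.1)
    (h2 : Disjoint p.1 r.1) (h3 : Disjoint q.1 r.1) : phi a p + phi a q + phi a r = 0 := by
  have hu : p.1 ∪ q.1 ∪ r.1 = Finset.univ := by
    apply Finset.eq_univ_of_card
    rw [Finset.card_union_of_disjoint (Finset.disjoint_union_left.2 ⟨h2, h3⟩),
      Finset.card_union_of_disjoint h1, p.2, q.2, r.2]
    rfl
  simp only [phi, LinearMap.coe_mk, AddHom.coe_mk, ← Finset.sum_add_distrib]
  refine Finset.sum_eq_zero fun k _ => ?_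
  have hk : k.castSucc ∈ p.1 ∪ q.1 ∪ r.1 := hu ▸ Finset.mem_univ _
  rw [Finset.disjoint_left] at h1 h2 h3
  have t := CharTwo.add_self_eq_zero (a k)
  simp only [Finset.mem_union] at hk
  have := @h1 k.castSucc
  have := @h2 k.castSucc
  have := @h3 k.castSucc
  split_ifs <;> simp_all

theorem generic_solve {R : Type} [CommRing R] (t : (2 : R) = 0) (x01 x02 x03 x04 x05 x12 x13 x14 x15 x23 x24 x25 x34 x35 x45 : R)
    (h0 : x01 + x23 + x45 = 0) (h1 : x01 + x24 + x35 = 0) (h2 : x01 + x25 + x34 = 0)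
    (h3 : x02 + x13 + x45 = 0) (h4 : x02 + x14 + x35 = 0) (h5 : x02 + x15 + x34 = 0)
    (h6 : x03 + x12 + x45 = 0) (h7 : x03 + x14 + x25 = 0) (h8 : x03 + x15 + x24 = 0)
    (h9 : x04 + x12 + x35 = 0) (h10 : x04 + x13 + x25 = 0) (h11 : x04 + x15 + x23 = 0)
    (h12 : x05 + x12 + x34 = 0) (h13 : x05 + x13 + x24 = 0) (h14 : x05 + x14 + x23 = 0)
    :
    0 + 0 + (x01 + x05 + x15 + x25) + (x01 + x05 + x15 + x35) + (x01 + x05 + x15 + x45) = x01 ∧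
    0 + (x01 + x05 + x15 + x15) + 0 + (x01 + x05 + x15 + x35) + (x01 + x05 + x15 + x45) = x02 ∧
    0 + (x01 + x05 + x15 + x15) + (x01 + x05 + x15 + x25) + 0 + (x01 + x05 + x15 + x45) = x03 ∧
    0 + (x01 + x05 + x15 + x15) + (x01 + x05 + x15 + x25) + (x01 + x05 + x15 + x35) + 0 = x04 ∧
    0 + (x01 + x05 + x15 + x15) + (x01 + x05 + x15 + x25) + (x01 + x05 + x15 + x35) + (x01 + x05 + x15 + x45) = x05 ∧
    (x01 + x05 + x15 + x05) + 0 + 0 + (x01 + x05 + x15 + x35) + (x01 + x05 + x15 + x45) = x12 ∧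
    (x01 + x05 + x15 + x05) + 0 + (x01 + x05 + x15 + x25) + 0 + (x01 + x05 + x15 + x45) = x13 ∧
    (x01 + x05 + x15 + x05) + 0 + (x01 + x05 + x15 + x25) + (x01 + x05 + x15 + x35) + 0 = x14 ∧
    (x01 + x05 + x15 + x05) + 0 + (x01 + x05 + x15 + x25) + (x01 + x05 + x15 + x35) + (x01 + x05 + x15 + x45) = x15 ∧
    (x01 + x05 + x15 + x05) + (x01 + x05 + x15 + x15) + 0 + 0 + (x01 + x05 + x15 + x45) = x23 ∧
    (x01 + x05 + x15 + x05) + (x01 + x05 + x15 + x15) + 0 + (x01 + x05 + x15 + x35) + 0 = x24 ∧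
    (x01 + x05 + x15 + x05) + (x01 + x05 + x15 + x15) + 0 + (x01 + x05 + x15 + x35) + (x01 + x05 + x15 + x45) = x25 ∧
    (x01 + x05 + x15 + x05) + (x01 + x05 + x15 + x15) + (x01 + x05 + x15 + x25) + 0 + 0 = x34 ∧
    (x01 + x05 + x15 + x05) + (x01 + x05 + x15 + x15) + (x01 + x05 + x15 + x25) + 0 + (x01 + x05 + x15 + x45) = x35 ∧
    (x01 + x05 + x15 + x05) + (x01 + x05 + x15 + x15) + (x01 + x05 + x15 + x25) + (x01 + x05 + x15 + x35) + 0 = x45 := by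
  refine ⟨?_, ?_, ?_, ?_, ?_, ?_, ?_, ?_, ?_, ?_, ?_, ?_, ?_, ?_, ?_⟩ <;> grind

theorem phi_surj (f : GQP → ZMod 2)
    (L : ∀ p q r : GQP, Disjoint p.1 q.1 → Disjoint p.1 r.1 → Disjoint q.1 r.1 →
      f p + f q + f r = 0) : ∃ a, phi a = f := by
  have h0 := L (pt 0 1 (by decide)) (pt 2 3 (by decide)) (pt 4 5 (by decide)) (by decide) (by decide) (by decide)
  have h1 := L (pt 0 1 (by decide)) (pt 2 4 (by decide)) (pt 3 5 (by decide)) (by decide) (by decide) (by decide)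
  have h2 := L (pt 0 1 (by decide)) (pt 2 5 (by decide)) (pt 3 4 (by decide)) (by decide) (by decide) (by decide)
  have h3 := L (pt 0 2 (by decide)) (pt 1 3 (by decide)) (pt 4 5 (by decide)) (by decide) (by decide) (by decide)
  have h4 := L (pt 0 2 (by decide)) (pt 1 4 (by decide)) (pt 3 5 (by decide)) (by decide) (by decide) (by decide)
  have h5 := L (pt 0 2 (by decide)) (pt 1 5 (by decide)) (pt 3 4 (by decide)) (by decide) (by decide) (by decide)
  have h6 := L (pt 0 3 (by decide)) (pt 1 2 (by decide)) (pt 4 5 (by decide)) (by decide) (by decide) (by decide)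
  have h7 := L (pt 0 3 (by decide)) (pt 1 4 (by decide)) (pt 2 5 (by decide)) (by decide) (by decide) (by decide)
  have h8 := L (pt 0 3 (by decide)) (pt 1 5 (by decide)) (pt 2 4 (by decide)) (by decide) (by decide) (by decide)
  have h9 := L (pt 0 4 (by decide)) (pt 1 2 (by decide)) (pt 3 5 (by decide)) (by decide) (by decide) (by decide)
  have h10 := L (pt 0 4 (by decide)) (pt 1 3 (by decide)) (pt 2 5 (by decide)) (by decide) (by decide) (by decide)
  have h11 := L (pt 0 4 (by decide)) (pt 1 5 (by decide)) (pt 2 3 (by decide)) (by decide) (by decide) (by decide)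
  have h12 := L (pt 0 5 (by decide)) (pt 1 2 (by decide)) (pt 3 4 (by decide)) (by decide) (by decide) (by decide)
  have h13 := L (pt 0 5 (by decide)) (pt 1 3 (by decide)) (pt 2 4 (by decide)) (by decide) (by decide) (by decide)
  have h14 := L (pt 0 5 (by decide)) (pt 1 4 (by decide)) (pt 2 3 (by decide)) (by decide) (by decide) (by decide)
  have comm (i j : Fin 6) (h : i ≠ j) : pt i j h = pt j i h.symm :=
    Subtype.ext (Finset.pair_comm i j)
  have t := two_zero
  let S := f (pt 0 1 (by decide)) + f (pt 0 5 (by decide)) + f (pt 1 5 (by decide))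
  obtain ⟨c0, c1, c2, c3, c4, c5, c6, c7, c8, c9, c10, c11, c12, c13, c14⟩ := generic_solve t _ _ _ _ _ _ _ _ _ _ _ _ _ _ _
    h0 h1 h2 h3 h4 h5 h6 h7 h8 h9 h10 h11 h12 h13 h14
  refine ⟨fun i => S + f (pt i.castSucc 5 (by revert i; decide)), ?_⟩
  have key : ∀ i j : Fin 6, ∀ h : i < j, phi (fun i => S + f (pt i.castSucc 5
      (by revert i; decide))) (pt i j h.ne) = f (pt i j h.ne) := by
    intro i j h
    rw [phi_pt]
    fin_cases i <;> fin_cases j <;> first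
      | exact absurd h (by decide)
      | (simp +decide only [Fin.sum_univ_five, if_true, if_false, S]
         first | exact c0 | exact c1 | exact c2 | exact c3 | exact c4 | exact c5 | exact c6 | exact c7 | exact c8 | exact c9 | exact c10 | exact c11 | exact c12 | exact c13 | exact c14)
  ext ⟨p, hp⟩
  obtain ⟨i, j, hij, rfl⟩ := Finset.card_eq_two.1 hp
  rcases lt_or_gt_of_ne hij with h | h
  · exact key i j h
  · have := key j i h
    rw [← comm i j hij] at this
    exact this

theorem card_iff (H : Finset GQP) (p q r : GQP) (h1 : p ≠ q) (h2 : p ≠ r) (h3 : q ≠ r) :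
    (({p, q, r} ∩ H : Finset GQP).card = 1 ∨ ({p, q, r} ∩ H : Finset GQP).card = 3) ↔
      fH H p + fH H q + fH H r = 0 := by
  have t : (1 : ZMod 2) + 1 = 0 := rfl
  by_cases a : p ∈ H <;> by_cases b : q ∈ H <;> by_cases c : r ∈ H <;>
    simp [fH, a, b, c, Finset.insert_inter_of_mem, Finset.insert_inter_of_notMem,
      Finset.singleton_inter_of_mem, Finset.singleton_inter_of_notMem, h1, h2, h3, t]

theorem ne_of_disj (p q : GQP) (h : Disjoint p.1 q.1) : p ≠ q := by
  rintro rfl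
  have := p.2
  rw [disjoint_self.1 h] at this
  simp at this

theorem hyp_iff (H : Finset GQP) :
    (∀ L : Finset GQP, GQLine L → (L ∩ H).card = 1 ∨ (L ∩ H).card = 3) ↔
      ∃ a, phi a = fH H := by
  constructor
  · intro h
    apply phi_surj
    intro p q r h1 h2 h3
    have n1 := ne_of_disj _ _ h1
    have n2 := ne_of_disj _ _ h2
    have n3 := ne_of_disj _ _ h3
    rw [← card_iff H p q r n1 n2 n3]
    refine h _ ⟨Finset.card_eq_three.2 ⟨p, q, r, n1, n2, n3, rfl⟩, ?_⟩
    simp [h1, h2, h3, h1.symm, h2.symm, h3.symm]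
  · rintro ⟨a, ha⟩ L ⟨hc, hd⟩
    obtain ⟨p, q, r, n1, n2, n3, rfl⟩ := Finset.card_eq_three.1 hc
    rw [card_iff H p q r n1 n2 n3, ← ha]
    exact phi_line a p q r (hd _ (by simp) _ (by simp) n1) (hd _ (by simp) _ (by simp) n2)
      (hd _ (by simp) _ (by simp) n3)

theorem fH_zero (H : Finset GQP) : fH H = 0 ↔ H = Finset.univ := by
  have t : (1 : ZMod 2) + 1 = 0 := rfl
  rw [funext_iff, Finset.eq_univ_iff_forall]
  refine forall_congr' fun p => ?_
  by_cases h : p ∈ H <;> simp [fH, h, t]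

theorem exists_fH (f : GQP → ZMod 2) : ∃ H, f = fH H := by
  refine ⟨Finset.univ.filter fun p => f p = 0, ?_⟩
  ext1 p
  simp only [fH, Finset.mem_filter, Finset.mem_univ, true_and]
  generalize f p = x
  revert x
  decide

/-- The set consisting of `0` and the functions `1 + χ_H`, for `H` ranging over the
geometric hyperplanes of GQ(2,2), is an `F₂`-linear subspace of `GQP → ZMod 2` of
dimension 5; hence the Veldkamp space of GQ(2,2) is isomorphic to PG(4,2). -/
theorem veldkamp_space_GQ :
    ∃ W : Submodule (ZMod 2) (GQP → ZMod 2),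
      (W : Set (GQP → ZMod 2)) = {0} ∪ {f | ∃ H : Finset GQP, GQHyp H ∧ f = fH H} ∧
      Module.finrank (ZMod 2) W = 5 := by
  refine ⟨LinearMap.range phi, ?_, ?_⟩
  · ext f
    simp only [SetLike.mem_coe, LinearMap.mem_range, Set.mem_union, Set.mem_singleton_iff,
      Set.mem_ofPred_eq]
    constructor
    · intro hf
      by_cases h0 : f = 0
      · exact Or.inl h0
      · obtain ⟨H, rfl⟩ := exists_fH f
        exact Or.inr ⟨H, ⟨fun h => h0 ((fH_zero H).2 h), (hyp_iff H).2 hf⟩, rfl⟩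
    · rintro (rfl | ⟨H, hH, rfl⟩)
      · exact ⟨0, map_zero _⟩
      · exact (hyp_iff H).1 hH.2
  · rw [LinearMap.finrank_range_of_inj phi_inj]
    simp
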